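/- Let D ⊆ ℝ^d and D' ⊆ ℝ^{d'} be domains and let G† : C(cl D; ℝ) → C(cl D'; ℝ) be a continuous map. Let σ1 ∈ A^L_0 and σ2, σ3 ∈ A_0. Then for every compact set K ⊆ C(cl D; ℝ) and every 0 < ε ≤ 1 there exist N ∈ ℕ and a neural operator G ∈ NO_N(σ1, σ2, σ3; D, D') such that sup_{a∈K} sup_{x∈cl D'} |G†(a)(x) − G(a)(x)| ≤ ε. -/

import Mathlib

open MeasureTheory Filter
open scoped ENNReal BigOperators

noncomputable section

/-- `IsNNRep σ n m f` : `f` is of the form `x ↦ W_n σ(… W_1 σ(W_0 x + b_0) + b_1 …) + b_n`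
with output dimension `m`. -/
def IsNNRep (σ : ℝ → ℝ) {ι : Type*} [Fintype ι] :
    ℕ → (m : ℕ) → ((ι → ℝ) → (Fin m → ℝ)) → Prop
  | 0, m, f => ∃ (W : Matrix (Fin m) ι ℝ) (b : Fin m → ℝ),
      f = fun x => W.mulVec x + b
  | n + 1, m, f => ∃ (k : ℕ) (g : (ι → ℝ) → (Fin k → ℝ))
      (W : Matrix (Fin m) (Fin k) ℝ) (b : Fin m → ℝ),
      IsNNRep σ n k g ∧ f = fun x => W.mulVec (fun i => σ (g x i)) + b

/-- `f` is an `n`-layer real-valued `σ`-neural network. -/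
def IsNN (σ : ℝ → ℝ) {ι : Type*} [Fintype ι] (n : ℕ) (f : (ι → ℝ) → ℝ) : Prop :=
  ∃ g : (ι → ℝ) → (Fin 1 → ℝ), IsNNRep σ n 1 g ∧ f = fun x => g x 0

/-- vector-valued neural networks, componentwise. -/
def IsNNV (σ : ℝ → ℝ) {ι : Type*} [Fintype ι] (n : ℕ) {m : ℕ}
    (f : (ι → ℝ) → (Fin m → ℝ)) : Prop :=
  ∀ i : Fin m, IsNN σ n fun x => f x i

/-- matrix-valued neural networks, entrywise. -/
def IsNNM (σ : ℝ → ℝ) {ι : Type*} [Fintype ι] (n : ℕ) {a b : ℕ}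
    (f : (ι → ℝ) → Matrix (Fin a) (Fin b) ℝ) : Prop :=
  ∀ (i : Fin a) (j : Fin b), IsNN σ n fun x => f x i j

/-- The class `A_0` of activation functions. -/
def MemA0 (σ : ℝ → ℝ) : Prop :=
  Continuous σ ∧ ∃ n : ℕ, ∀ (k : ℕ) (K : Set (Fin k → ℝ)), IsCompact K →
    ∀ f : (Fin k → ℝ) → ℝ, ContinuousOn f K → ∀ ε : ℝ, 0 < ε →
      ∃ g : (Fin k → ℝ) → ℝ, IsNN σ n g ∧ ∀ x ∈ K, |f x - g x| ≤ ε

/-- The class `A^L_0` of linearly bounded activation functions. -/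
def MemAL0 (σ : ℝ → ℝ) : Prop :=
  MemA0 σ ∧ Measurable σ ∧ ∃ C : ℝ, ∀ x : ℝ, |σ x| ≤ C * (1 + |x|)

/-- The class `BA` of activations admitting bounded approximations to the identity. -/
def MemBA (σ : ℝ → ℝ) : Prop :=
  MemA0 σ ∧ ∀ (k : ℕ) (K : Set (Fin k → ℝ)), IsCompact K →
    ∀ ε : ℝ, 0 < ε → ∀ C : ℝ, 0 ≤ C →
      (∀ x ∈ K, ∀ y ∈ K, Real.sqrt (∑ i, (x i - y i) ^ 2) ≤ C) →
      ∃ (n : ℕ) (f : (Fin k → ℝ) → (Fin k → ℝ)), IsNNV σ n f ∧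
        (∀ x ∈ K, Real.sqrt (∑ i, (f x i - x i) ^ 2) ≤ ε) ∧
        ∀ x, Real.sqrt (∑ i, (f x i) ^ 2) ≤ C

/-- A domain: bounded, connected, open, topologically regular. -/
def IsRegularDomain {k : ℕ} (D : Set (Fin k → ℝ)) : Prop :=
  IsOpen D ∧ IsConnected D ∧ Bornology.IsBounded D ∧ interior (closure D) = D

/-- affine kernel integral operators `IO(σ; D, ℝ^{d1}, ℝ^{d2})`. -/
def IsIO (σ : ℝ → ℝ) {d : ℕ} (D : Set (Fin d → ℝ)) (d1 d2 : ℕ)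
    (S : ((Fin d → ℝ) → (Fin d1 → ℝ)) → ((Fin d → ℝ) → (Fin d2 → ℝ))) : Prop :=
  ∃ (n1 n2 : ℕ) (κ : ((Fin d ⊕ Fin d) → ℝ) → Matrix (Fin d2) (Fin d1) ℝ)
    (b : (Fin d → ℝ) → (Fin d2 → ℝ)),
    IsNNM σ n1 κ ∧ IsNNV σ n2 b ∧
    S = fun f x => (∫ y in D, (κ (Sum.elim x y)).mulVec (f y)) + b x

/-- The chain `S_{n-1} σ1 (⋯ S_2 σ1 (S_1 (S_0 f)) ⋯)` of `n` integral operators. -/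
inductive NOChain (σ1 σ2 : ℝ → ℝ) {d : ℕ} (D : Set (Fin d → ℝ)) (da : ℕ) :
    ℕ → (m : ℕ) → (((Fin d → ℝ) → (Fin da → ℝ)) → ((Fin d → ℝ) → (Fin m → ℝ))) → Prop
  | base {d0 d1 : ℕ}
      {S0 : ((Fin d → ℝ) → (Fin da → ℝ)) → ((Fin d → ℝ) → (Fin d0 → ℝ))}
      {S1 : ((Fin d → ℝ) → (Fin d0 → ℝ)) → ((Fin d → ℝ) → (Fin d1 → ℝ))}
      (h0 : IsIO σ2 D da d0 S0) (h1 : IsIO σ2 D d0 d1 S1) :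
      NOChain σ1 σ2 D da 2 d1 fun f => S1 (S0 f)
  | step {n m m' : ℕ}
      {V : ((Fin d → ℝ) → (Fin da → ℝ)) → ((Fin d → ℝ) → (Fin m → ℝ))}
      {S : ((Fin d → ℝ) → (Fin m → ℝ)) → ((Fin d → ℝ) → (Fin m' → ℝ))}
      (hV : NOChain σ1 σ2 D da n m V) (hS : IsIO σ2 D m m' S) :
      NOChain σ1 σ2 D da (n + 1) m' fun f => S fun y i => σ1 (V f y i)

/-- `n`-layer neural operators `NO_n(σ1, σ2, σ3; D, D', ℝ^{da}, ℝ^{du})`. -/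
def IsNO (σ1 σ2 σ3 : ℝ → ℝ) {d d' : ℕ} (D : Set (Fin d → ℝ)) (D' : Set (Fin d' → ℝ))
    (da du n : ℕ)
    (G : ((Fin d → ℝ) → (Fin da → ℝ)) → ((Fin d' → ℝ) → (Fin du → ℝ))) : Prop :=
  ∃ (m : ℕ) (V : ((Fin d → ℝ) → (Fin da → ℝ)) → ((Fin d → ℝ) → (Fin m → ℝ)))
    (l : ℕ) (κ : ((Fin d' ⊕ Fin d) → ℝ) → Matrix (Fin du) (Fin m) ℝ),
    NOChain σ1 σ2 D da n m V ∧ IsNNM σ3 l κ ∧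
    G = fun f x => ∫ y in D, (κ (Sum.elim x y)).mulVec (V f y)

open Classical in
/-- Extension by zero of a bounded continuous function on a subset. -/
noncomputable def extendZero {α : Type*} [TopologicalSpace α] {s : Set α}
    (u : BoundedContinuousFunction s ℝ) : α → ℝ :=
  fun x => if h : x ∈ s then u ⟨x, h⟩ else 0


section NeuralNetworks

variable {σ : ℝ → ℝ} {ι ι' : Type*} [Fintype ι] [Fintype ι']

theorem IsNNRep.continuous (hσ : Continuous σ) :
    ∀ {n m : ℕ} {f : (ι → ℝ) → (Fin m → ℝ)}, IsNNRep σ n m f → Continuous f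
  | 0, _, _, ⟨W, b, hf⟩ => by
    subst hf
    exact (Continuous.matrix_mulVec continuous_const continuous_id).add continuous_const
  | _ + 1, _, _, ⟨_, g, W, b, hg, hf⟩ => by
    subst hf
    have hg' := hg.continuous hσ
    exact (Continuous.matrix_mulVec continuous_const
      (continuous_pi fun i => hσ.comp ((continuous_apply i).comp hg'))).add continuous_const

/-- Precomposing a network with a relabelling of the input coordinates gives a network. -/
theorem IsNNRep.comp_reindex (e : ι → ι') :
    ∀ {n m : ℕ} {f : (ι → ℝ) → (Fin m → ℝ)}, IsNNRep σ n m f →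
      IsNNRep σ n m fun z : ι' → ℝ => f (z ∘ e)
  | 0, _, _, ⟨W, b, hf⟩ => by
    classical
    subst hf
    refine ⟨W * (1 : Matrix ι' ι' ℝ).submatrix e id, b, ?_⟩
    funext z
    have hz : ((1 : Matrix ι' ι' ℝ).submatrix e id).mulVec z = z ∘ e := by
      funext i
      simp [Matrix.mulVec, dotProduct, Matrix.one_apply]
    rw [← Matrix.mulVec_mulVec, hz]
  | _ + 1, _, _, ⟨k, g, W, b, hg, hf⟩ => by
    subst hf
    exact ⟨k, _, W, b, hg.comp_reindex e, rfl⟩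

/-- Networks of the same depth can be run in parallel. -/
theorem IsNNRep.parallel {s : ℕ} :
    ∀ {n M : ℕ} {k : Fin s → ℕ} {f : (j : Fin s) → (ι → ℝ) → (Fin (k j) → ℝ)}
      (e : Fin M ≃ (j : Fin s) × Fin (k j)), (∀ j, IsNNRep σ n (k j) (f j)) →
      IsNNRep σ n M fun x i => f (e i).1 x (e i).2
  | 0, _, _, _, e, h => by
    choose W b hf using h
    obtain rfl := funext hf
    exact ⟨Matrix.of fun i => W (e i).1 (e i).2, fun i => b (e i).1 (e i).2, rfl⟩
  | _ + 1, _, _, _, e, h => by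
    choose k' g W b hg hf using h
    obtain rfl := funext hf
    refine ⟨_, _, (Matrix.blockDiagonal' W).submatrix e finSigmaFinEquiv.symm,
      fun i => b (e i).1 (e i).2, IsNNRep.parallel finSigmaFinEquiv.symm hg, ?_⟩
    funext x i
    simp only [Pi.add_apply, Matrix.mulVec, dotProduct, Matrix.submatrix_apply]
    congr 1
    rw [Equiv.sum_comp finSigmaFinEquiv.symm
      fun p => Matrix.blockDiagonal' W (e i) p * σ (g p.1 x p.2), Fintype.sum_sigma,
      Finset.sum_eq_single (e i).1]
    · refine Finset.sum_congr rfl fun l _ => ?_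
      rw [← Matrix.blockDiagonal'_apply_eq W (e i).1]
    · intro j _ hj
      refine Finset.sum_eq_zero fun l _ => ?_
      rw [show e i = ⟨(e i).1, (e i).2⟩ from rfl, Matrix.blockDiagonal'_apply_ne _ _ _ hj.symm,
        zero_mul]
    · simp

theorem IsNNRep.const (n : ℕ) {m : ℕ} (c : Fin m → ℝ) :
    IsNNRep σ n m fun _ : ι → ℝ => c := by
  induction n generalizing m with
  | zero => exact ⟨0, c, by simp⟩
  | succ n ih => exact ⟨0, _, 0, c, ih Fin.elim0, by simp⟩

theorem IsNN.const (n : ℕ) (c : ℝ) : IsNN σ n fun _ : ι → ℝ => c :=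
  ⟨_, IsNNRep.const n fun _ => c, rfl⟩

theorem IsNN.continuous (hσ : Continuous σ) {n : ℕ} {f : (ι → ℝ) → ℝ} (hf : IsNN σ n f) :
    Continuous f := by
  obtain ⟨g, hg, rfl⟩ := hf
  exact (continuous_apply 0).comp (hg.continuous hσ)

theorem IsNN.comp_reindex (e : ι → ι') {n : ℕ} {f : (ι → ℝ) → ℝ} (hf : IsNN σ n f) :
    IsNN σ n fun z : ι' → ℝ => f (z ∘ e) := by
  obtain ⟨g, hg, rfl⟩ := hf
  exact ⟨_, hg.comp_reindex e, rfl⟩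

theorem IsNN.const_mul (c : ℝ) {n : ℕ} {f : (ι → ℝ) → ℝ} (hf : IsNN σ n f) :
    IsNN σ n fun x => c * f x := by
  obtain ⟨g, hg, rfl⟩ := hf
  refine ⟨fun x => c • g x, ?_, rfl⟩
  cases n with
  | zero =>
    obtain ⟨W, b, rfl⟩ := hg
    exact ⟨c • W, c • b, by simp [Matrix.smul_mulVec]⟩
  | succ n =>
    obtain ⟨k, g, W, b, hg, rfl⟩ := hg
    exact ⟨k, g, c • W, c • b, hg, by simp [Matrix.smul_mulVec]⟩

theorem IsNNRep.of_isNN {n s : ℕ} {f : Fin s → (ι → ℝ) → ℝ} (hf : ∀ j, IsNN σ n (f j)) :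
    IsNNRep σ n s fun x j => f j x := by
  choose g hg hfg using hf
  obtain rfl := funext hfg
  exact IsNNRep.parallel (Equiv.sigmaUnique (Fin s) fun _ => Fin 1).symm hg

end NeuralNetworks

section ConstantLayers

variable {d : ℕ} {D : Set (Fin d → ℝ)}

/-- An affine map of vectors acts on constant functions as an integral operator. -/
theorem exists_affine_integral_operator (σ : ℝ → ℝ) (hD0 : volume.real D ≠ 0) {k m : ℕ}
    (W : Matrix (Fin m) (Fin k) ℝ) (b : Fin m → ℝ) :
    ∃ S, IsIO σ D k m S ∧ ∀ c x, S (fun _ => c) x = W.mulVec c + b := by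
  refine ⟨_, ⟨0, 0, fun _ => (volume.real D)⁻¹ • W, fun _ => b, fun i j => IsNN.const 0 _,
    fun i => IsNN.const 0 _, rfl⟩, fun c x => ?_⟩
  simp [Matrix.smul_mulVec, smul_smul, hD0]

/-- Integral features followed by a network form a chain of integral operators with
constant values. -/
theorem exists_noChain_features {σ1 σ2 : ℝ → ℝ} (hD0 : volume.real D ≠ 0) {k n2 : ℕ}
    {φ : Fin k → (Fin d → ℝ) → ℝ} (hφ : ∀ i, IsNN σ2 n2 (φ i)) (β : Fin k → ℝ) :
    ∀ {n m : ℕ} {F : (Fin k → ℝ) → (Fin m → ℝ)}, IsNNRep σ1 n m F →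
      ∃ V, NOChain σ1 σ2 D 1 (n + 2) m V ∧
        ∀ f x, V f x = F ((∫ y in D, fun i => φ i y * f y 0) + β)
  | 0, _, _, ⟨W, b, hF⟩ => by
    obtain ⟨S, hS, hSW⟩ := exists_affine_integral_operator σ2 hD0 W b
    refine ⟨_, NOChain.base ⟨n2, 0, fun z => Matrix.of fun i _ => φ i (z ∘ Sum.inr), fun _ => β,
      fun i _ => (hφ i).comp_reindex Sum.inr, fun i => IsNN.const 0 _, rfl⟩ hS, fun f x => ?_⟩
    simp only [hF, ← hSW _ x]
    congr 1
    funext x'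
    congr 2
    funext y i
    simp [Matrix.mulVec, dotProduct]
  | n + 1, _, _, ⟨_, g, W, b, hg, hF⟩ => by
    obtain ⟨V, hV, hVg⟩ := exists_noChain_features hD0 hφ β hg
    obtain ⟨S, hS, hSW⟩ := exists_affine_integral_operator σ2 hD0 W b
    refine ⟨_, NOChain.step hV hS, fun f x => ?_⟩
    simp only [hVg, hF, hSW]

theorem exists_neural_operator_features {σ1 σ2 σ3 : ℝ → ℝ} (hD0 : volume.real D ≠ 0) {d' k s n1 n2 n3 : ℕ}
    (D' : Set (Fin d' → ℝ))
    {φ : Fin k → (Fin d → ℝ) → ℝ} (hφ : ∀ i, IsNN σ2 n2 (φ i)) (β : Fin k → ℝ)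
    {F : Fin s → (Fin k → ℝ) → ℝ} (hF : ∀ j, IsNN σ1 n1 (F j))
    {ψ : Fin s → (Fin d' → ℝ) → ℝ} (hψ : ∀ j, IsNN σ3 n3 (ψ j)) :
    ∃ N G, IsNO σ1 σ2 σ3 D D' 1 1 N G ∧
      ∀ f x, G f x 0 = ∑ j, F j ((∫ y in D, fun i => φ i y * f y 0) + β) * ψ j x := by
  obtain ⟨V, hV, hVF⟩ := exists_noChain_features (σ1 := σ1) hD0 hφ β (IsNNRep.of_isNN hF)
  refine ⟨_, _, ⟨s, V, n3,
    fun z => Matrix.of fun _ j => (volume.real D)⁻¹ * ψ j (z ∘ Sum.inl), hV,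
    fun _ j => ((hψ j).comp_reindex Sum.inl).const_mul _, rfl⟩, fun f x => ?_⟩
  simp only [hVF, Sum.elim_comp_inl, setIntegral_const, Pi.smul_apply, Matrix.mulVec, dotProduct, Matrix.of_apply,
    smul_eq_mul, Finset.mul_sum]
  refine Finset.sum_congr rfl fun j _ => ?_
  field_simp

end ConstantLayers

section Features

variable {d : ℕ} {D : Set (Fin d → ℝ)}

theorem extendZero_of_mem {α : Type*} [TopologicalSpace α] {s : Set α}
    (u : BoundedContinuousFunction s ℝ) {x : α} (hx : x ∈ s) : extendZero u x = u ⟨x, hx⟩ :=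
  dif_pos hx

theorem extendZero_sub {α : Type*} [TopologicalSpace α] {s : Set α}
    (u v : BoundedContinuousFunction s ℝ) (x : α) :
    extendZero (u - v) x = extendZero u x - extendZero v x := by
  unfold extendZero
  split_ifs <;> simp

theorem abs_extendZero_le {α : Type*} [TopologicalSpace α] {s : Set α}
    (u : BoundedContinuousFunction s ℝ) (x : α) : |extendZero u x| ≤ ‖u‖ := by
  unfold extendZero
  split_ifs with h
  · exact u.norm_coe_le_norm _
  · simp

theorem continuousOn_extendZero {α : Type*} [TopologicalSpace α] {s : Set α}
    (u : BoundedContinuousFunction s ℝ) : ContinuousOn (extendZero u) s := by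
  rw [continuousOn_iff_continuous_domRestrict]
  convert u.continuous using 1
  funext x
  exact extendZero_of_mem u x.2

theorem isCompact_closure_of_isRegularDomain (hD : IsRegularDomain D) : IsCompact (closure D) :=
  hD.2.2.1.isCompact_closure

theorem integrableOn_of_continuousOn_closure (hD : IsRegularDomain D) {f : (Fin d → ℝ) → ℝ}
    (hf : ContinuousOn f (closure D)) : IntegrableOn f D :=
  (hf.integrableOn_compact (isCompact_closure_of_isRegularDomain hD)).mono_set subset_closure

theorem volume_real_ne_zero (hD : IsRegularDomain D) : volume.real D ≠ 0 :=
  ENNReal.toReal_ne_zero.2 ⟨(hD.1.measure_pos volume hD.2.1.nonempty).ne',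
    hD.2.2.1.measure_lt_top.ne⟩

theorem integrableOn_mul_extendZero (hD : IsRegularDomain D) {φ : (Fin d → ℝ) → ℝ}
    (hφ : Continuous φ) (a : BoundedContinuousFunction (closure D) ℝ) :
    IntegrableOn (fun y => φ y * extendZero a y) D :=
  integrableOn_of_continuousOn_closure hD (hφ.continuousOn.mul (continuousOn_extendZero a))

theorem continuous_setIntegral_mul_extendZero (hD : IsRegularDomain D) {φ : (Fin d → ℝ) → ℝ}
    (hφ : Continuous φ) :
    Continuous fun a : BoundedContinuousFunction (closure D) ℝ =>
      ∫ y in D, φ y * extendZero a y := by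
  obtain ⟨M, hM⟩ := (isCompact_closure_of_isRegularDomain hD).exists_bound_of_continuousOn
    hφ.continuousOn
  refine (LipschitzWith.of_dist_le_mul (K := Real.toNNReal (|M| * volume.real D))
    fun a b => ?_).continuous
  rw [Real.coe_toNNReal _ (by positivity), dist_eq_norm, dist_eq_norm,
    ← integral_sub (integrableOn_mul_extendZero hD hφ a) (integrableOn_mul_extendZero hD hφ b)]
  refine (norm_setIntegral_le_of_norm_le_const (C := |M| * ‖a - b‖) hD.2.2.1.measure_lt_top
    fun y hy => ?_).trans (le_of_eq (by ring))
  rw [← mul_sub, ← extendZero_sub, norm_mul]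
  gcongr
  · exact (hM y (subset_closure hy)).trans (le_abs_self M)
  · exact abs_extendZero_le _ _

/-- Continuous functions on the closure of a domain are separated by integration against
a class of functions that is uniformly dense. -/
theorem exists_setIntegral_mul_extendZero_ne (hD : IsRegularDomain D)
    {P : ((Fin d → ℝ) → ℝ) → Prop} (hP : ∀ φ, P φ → Continuous φ)
    (hdense : ∀ f, ContinuousOn f (closure D) → ∀ ε : ℝ, 0 < ε →
      ∃ φ, P φ ∧ ∀ x ∈ closure D, |f x - φ x| ≤ ε)
    {a b : BoundedContinuousFunction (closure D) ℝ} (hab : a ≠ b) :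
    ∃ φ, P φ ∧ ∫ y in D, φ y * extendZero a y ≠ ∫ y in D, φ y * extendZero b y := by
  by_contra! h
  apply hab
  set u := extendZero (a - b) with hu
  have huc : ContinuousOn u (closure D) := continuousOn_extendZero _
  have horth : ∀ φ, P φ → ∫ y in D, φ y * u y = 0 := fun φ hφ => by
    simp only [hu, extendZero_sub, mul_sub]
    rw [integral_sub (integrableOn_mul_extendZero hD (hP φ hφ) a)
      (integrableOn_mul_extendZero hD (hP φ hφ) b), h φ hφ, sub_self]
  have hsq_int : IntegrableOn (fun y => u y * u y) D :=
    integrableOn_of_continuousOn_closure hD (huc.mul huc)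
  have hle : ∀ δ : ℝ, 0 < δ → ∫ y in D, u y * u y ≤ δ * (‖a - b‖ * volume.real D) := by
    intro δ hδ
    obtain ⟨φ, hφ, hφu⟩ := hdense u huc δ hδ
    have hφ_int := integrableOn_mul_extendZero hD (hP φ hφ) (a - b)
    have heq : ∫ y in D, u y * u y = ∫ y in D, (u y * u y - φ y * u y) := by
      rw [integral_sub hsq_int hφ_int, horth φ hφ, sub_zero]
    rw [heq, ← mul_assoc]
    refine (Real.le_norm_self _).trans (norm_setIntegral_le_of_norm_le_const
      hD.2.2.1.measure_lt_top fun y hy => ?_)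
    rw [← sub_mul, norm_mul]
    gcongr
    · exact hφu y (subset_closure hy)
    · exact abs_extendZero_le _ _
  have hzero : ∫ y in D, u y * u y = 0 := by
    refine le_antisymm ?_ (integral_nonneg fun y => mul_self_nonneg (u y))
    have hlim : Tendsto (fun δ : ℝ => δ * (‖a - b‖ * volume.real D)) (nhdsWithin 0 (Set.Ioi 0))
        (nhds 0) := by
      have : Continuous fun δ : ℝ => δ * (‖a - b‖ * volume.real D) := by fun_prop
      simpa using (this.tendsto 0).mono_left nhdsWithin_le_nhds
    exact ge_of_tendsto hlim (eventually_mem_nhdsWithin.mono hle)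
  rw [setIntegral_eq_zero_iff_of_nonneg_ae (Eventually.of_forall fun y => mul_self_nonneg (u y))
    hsq_int] at hzero
  have hD0 : Set.EqOn (fun y => u y * u y) 0 D :=
    Measure.eqOn_open_of_ae_eq hzero hD.1 ((huc.mul huc).mono subset_closure) continuousOn_const
  have hcl : Set.EqOn (fun y => u y * u y) 0 (closure D) :=
    hD0.of_subset_closure (huc.mul huc) continuousOn_const subset_closure subset_rfl
  ext x
  have hx : u x = 0 := mul_self_eq_zero.1 (hcl x.2)
  rw [hu, extendZero_of_mem _ x.2] at hx
  simpa [sub_eq_zero] using hx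

end Features

/-- A continuous function on a compact set is approximated by polynomials in a family of
continuous functions separating points. -/
theorem exists_mvPolynomial_near_of_separatesPoints {X I : Type*} [TopologicalSpace X]
    (w : I → C(X, ℝ)) (hw : ∀ x y, x ≠ y → ∃ i, w i x ≠ w i y) (f : C(X, ℝ)) {K : Set X}
    (hK : IsCompact K) {ε : ℝ} (hε : 0 < ε) :
    ∃ (n : ℕ) (i : Fin n → I) (q : MvPolynomial (Fin n) ℝ),
      ∀ x ∈ K, |f x - MvPolynomial.eval (fun j => w (i j) x) q| < ε := by
  have hsep : (Algebra.adjoin ℝ (Set.range w)).SeparatesPoints := fun x y hxy => by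
    obtain ⟨i, hi⟩ := hw x y hxy
    exact ⟨w i, ⟨w i, Algebra.subset_adjoin ⟨i, rfl⟩, rfl⟩, hi⟩
  obtain ⟨g, hg, hgf⟩ :=
    ContinuousMap.exists_mem_subalgebra_near_continuous_of_isCompact_of_separatesPoints
      hsep f hK hε
  rw [Algebra.adjoin_range_eq_range_aeval] at hg
  obtain ⟨p, rfl⟩ := hg
  obtain ⟨n, i, -, q, rfl⟩ := MvPolynomial.exists_fin_rename p
  refine ⟨n, i, q, fun x hx => ?_⟩
  have heval : (MvPolynomial.aeval w (MvPolynomial.rename i q) : C(X, ℝ)) x =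
      MvPolynomial.eval (fun j => w (i j) x) q := by
    rw [MvPolynomial.aeval_rename]
    exact (MvPolynomial.comp_aeval_apply (f := w ∘ i) (ContinuousMap.evalAlgHom ℝ ℝ x) q).trans
      (congrArg (fun h => h q) (MvPolynomial.coe_aeval_eq_eval _))
  rw [← heval, abs_sub_comm]
  exact hgf x hx

/-- Finite sums of products of bounded functions are stable under uniform approximation
of the factors. -/
theorem exists_pos_forall_abs_sum_mul_sub_le {X Y : Type*} {s : ℕ} {U : Set X} {V : Set Y}
    {g : Fin s → X → ℝ} {ψ : Fin s → Y → ℝ} {M : ℝ} (hM : 0 ≤ M)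
    (hg : ∀ j, ∀ x ∈ U, |g j x| ≤ M) (hψ : ∀ j, ∀ y ∈ V, |ψ j y| ≤ M) {ε : ℝ} (hε : 0 < ε) :
    ∃ δ > 0, ∀ (F : Fin s → X → ℝ) (κ : Fin s → Y → ℝ),
      (∀ j, ∀ x ∈ U, |g j x - F j x| ≤ δ) → (∀ j, ∀ y ∈ V, |ψ j y - κ j y| ≤ δ) →
      ∀ x ∈ U, ∀ y ∈ V, |∑ j, g j x * ψ j y - ∑ j, F j x * κ j y| ≤ ε := by
  have hpos : 0 < (s + 1) * (2 * M + 1) := by positivity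
  refine ⟨min 1 (ε / ((s + 1) * (2 * M + 1))), lt_min one_pos (div_pos hε hpos),
    fun F κ hF hκ x hx y hy => ?_⟩
  set δ := min 1 (ε / ((s + 1) * (2 * M + 1)))
  have hδ0 : 0 < δ := lt_min one_pos (div_pos hε hpos)
  have hδ1 : δ ≤ 1 := min_le_left _ _
  have hδε : δ * ((s + 1) * (2 * M + 1)) ≤ ε := (le_div_iff₀ hpos).1 (min_le_right _ _)
  have hterm : ∀ j, |g j x * ψ j y - F j x * κ j y| ≤ δ * (2 * M + 1) := fun j => by
    have hκM : |κ j y| ≤ M + 1 := by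
      have h1 := abs_le.1 (hψ j y hy)
      have h2 := abs_le.1 (hκ j y hy)
      exact abs_le.2 ⟨by linarith, by linarith⟩
    calc |g j x * ψ j y - F j x * κ j y|
        = |g j x * (ψ j y - κ j y) + (g j x - F j x) * κ j y| := by ring_nf
      _ ≤ |g j x| * |ψ j y - κ j y| + |g j x - F j x| * |κ j y| := by
        rw [← abs_mul, ← abs_mul]
        exact abs_add_le _ _
      _ ≤ M * δ + δ * (M + 1) := by
        gcongr
        exacts [hg j x hx, hκ j y hy, hF j x hx]
      _ = δ * (2 * M + 1) := by ring
  rw [← Finset.sum_sub_distrib]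
  calc |∑ j, (g j x * ψ j y - F j x * κ j y)|
      ≤ ∑ j : Fin s, |g j x * ψ j y - F j x * κ j y| := Finset.abs_sum_le_sum_abs _ _
    _ ≤ ∑ _j : Fin s, δ * (2 * M + 1) := Finset.sum_le_sum fun j _ => hterm j
    _ = s * (δ * (2 * M + 1)) := by simp
    _ ≤ δ * ((s + 1) * (2 * M + 1)) := by nlinarith [mul_pos hδ0 (show 0 < 2 * M + 1 by linarith)]
    _ ≤ ε := hδε

/-- A finite family of continuous functions is uniformly bounded on a compact set. -/
theorem exists_forall_abs_le_of_isCompact {X : Type*} [TopologicalSpace X] {s : ℕ} {U : Set X}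
    (hU : IsCompact U) {g : Fin s → X → ℝ} (hg : ∀ j, Continuous (g j)) :
    ∃ M, 0 ≤ M ∧ ∀ j, ∀ x ∈ U, |g j x| ≤ M := by
  choose B hB using fun j => hU.exists_bound_of_continuousOn (hg j).continuousOn
  exact ⟨∑ j, |B j|, by positivity, fun j x hx => (hB j x hx).trans ((le_abs_self _).trans
    (Finset.single_le_sum (f := fun j => |B j|) (fun _ _ => abs_nonneg _) (Finset.mem_univ j)))⟩

/-- Continuous operators are approximated, uniformly over compact sets, by finite sums of
functions of finitely many integral features times functions of the output variable. -/
theorem exists_sum_features_near {d d' : ℕ} {D : Set (Fin d → ℝ)} {E : Set (Fin d' → ℝ)}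
    (hD : IsRegularDomain D) (hE : IsCompact E)
    {T : BoundedContinuousFunction (closure D) ℝ → BoundedContinuousFunction E ℝ}
    (hT : Continuous T) {P : ((Fin d → ℝ) → ℝ) → Prop} (hP : ∀ φ, P φ → Continuous φ)
    (hP0 : P fun _ => 0)
    (hdense : ∀ f, ContinuousOn f (closure D) → ∀ ε : ℝ, 0 < ε →
      ∃ φ, P φ ∧ ∀ x ∈ closure D, |f x - φ x| ≤ ε)
    {K : Set (BoundedContinuousFunction (closure D) ℝ)} (hK : IsCompact K) {ε : ℝ} (hε : 0 < ε) :
    ∃ (k s : ℕ) (φ : Fin k → (Fin d → ℝ) → ℝ) (β : Fin k → ℝ) (g : Fin s → (Fin k → ℝ) → ℝ)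
      (ψ : Fin s → (Fin d' → ℝ) → ℝ), (∀ i, P (φ i)) ∧ (∀ j, Continuous (g j)) ∧
      (∀ j, Continuous (ψ j)) ∧ ∀ a ∈ K, ∀ x, ∀ hx : x ∈ E,
        |T a ⟨x, hx⟩ -
          ∑ j, g j (fun i => (∫ y in D, φ i y * extendZero a y) + β i) * ψ j x| < ε := by
  have : CompactSpace E := isCompact_iff_compactSpace.1 hE
  let w : {φ // P φ} × ℝ × C(Fin d' → ℝ, ℝ) →
      C(BoundedContinuousFunction (closure D) ℝ × E, ℝ) := fun i =>
    ⟨fun p => ((∫ y in D, i.1.1 y * extendZero p.1 y) + i.2.1) * i.2.2 p.2,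
      (((continuous_setIntegral_mul_extendZero hD (hP _ i.1.2)).comp continuous_fst).add
        continuous_const).mul (i.2.2.continuous.comp (continuous_subtype_val.comp continuous_snd))⟩
  have hw : ∀ p q, p ≠ q → ∃ i, w i p ≠ w i q := by
    rintro ⟨a, x⟩ ⟨b, y⟩ hpq
    by_cases hab : a = b
    · have hxy : (x : Fin d' → ℝ) ≠ y := fun h => hpq (by rw [hab, Subtype.ext h])
      obtain ⟨l, hl⟩ := Function.ne_iff.1 hxy
      exact ⟨⟨⟨_, hP0⟩, 1, ⟨fun z => z l, continuous_apply l⟩⟩, by simpa [w] using hl⟩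
    · obtain ⟨φ, hφ, hne⟩ := exists_setIntegral_mul_extendZero_ne hD hP hdense hab
      exact ⟨⟨⟨φ, hφ⟩, 0, 1⟩, by simpa [w] using hne⟩
  obtain ⟨n, i, q, hq⟩ := exists_mvPolynomial_near_of_separatesPoints w hw
    ⟨fun p => T p.1 p.2, (hT.comp continuous_fst).eval continuous_snd⟩
    (hK.prod isCompact_univ) hε
  let e := q.support.equivFin.symm
  refine ⟨n, _, fun j => (i j).1.1, fun j => (i j).2.1,
    fun m c => q.coeff (e m) * ∏ j, c j ^ (e m : Fin n →₀ ℕ) j,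
    fun m x => ∏ j, (i j).2.2 x ^ (e m : Fin n →₀ ℕ) j, fun j => (i j).1.2, fun m => ?_,
    fun m => ?_, fun a ha x hx => ?_⟩
  · fun_prop
  · fun_prop
  · convert hq (a, ⟨x, hx⟩) ⟨ha, Set.mem_univ _⟩ using 2
    refine congrArg (T a ⟨x, hx⟩ - ·) ?_
    rw [MvPolynomial.eval_eq', ← Finset.sum_coe_sort q.support, ← Equiv.sum_comp e]
    refine Finset.sum_congr rfl fun m _ => ?_
    rw [mul_assoc, ← Finset.prod_mul_distrib]
    simp [w, mul_pow]

/-- Universal approximation of continuous operators `C(cl D; ℝ) → C(cl D'; ℝ)` by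
neural operators, uniformly over compact sets (Theorem 11, continuous case). -/
theorem neural_operator_universal_approximation_C
    (d d' : ℕ) (D : Set (Fin d → ℝ)) (D' : Set (Fin d' → ℝ))
    (hD : IsRegularDomain D) (hD' : IsRegularDomain D')
    (Gdag : BoundedContinuousFunction (closure D) ℝ →
      BoundedContinuousFunction (closure D') ℝ)
    (hGdag : Continuous Gdag)
    (σ1 σ2 σ3 : ℝ → ℝ) (hσ1 : MemAL0 σ1) (hσ2 : MemA0 σ2) (hσ3 : MemA0 σ3)
    (K : Set (BoundedContinuousFunction (closure D) ℝ)) (hK : IsCompact K)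
    (ε : ℝ) (hε0 : 0 < ε) (hε1 : ε ≤ 1) :
    ∃ (N : ℕ) (G : ((Fin d → ℝ) → (Fin 1 → ℝ)) → ((Fin d' → ℝ) → (Fin 1 → ℝ))),
      IsNO σ1 σ2 σ3 D D' 1 1 N G ∧
      ∀ a ∈ K, ∀ x, ∀ hx : x ∈ closure D',
        |Gdag a ⟨x, hx⟩ - G (fun y _ => extendZero a y) x 0| ≤ ε := by
  obtain ⟨hσ1c, n1, hn1⟩ := hσ1.1
  obtain ⟨hσ2c, n2, hn2⟩ := hσ2
  obtain ⟨-, n3, hn3⟩ := hσ3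
  have hDc := isCompact_closure_of_isRegularDomain hD
  have hDc' := isCompact_closure_of_isRegularDomain hD'
  obtain ⟨k, s, φ, β, g, ψ, hφ, hg, hψ, hnear⟩ := exists_sum_features_near hD hDc' hGdag
    (P := IsNN σ2 n2) (fun _ h => h.continuous hσ2c) (IsNN.const n2 0) (hn2 d _ hDc) hK
    (half_pos hε0)
  have hφc : ∀ i, Continuous (φ i) := fun i => (hφ i).continuous hσ2c
  let c : BoundedContinuousFunction (closure D) ℝ → Fin k → ℝ :=
    fun a i => (∫ y in D, φ i y * extendZero a y) + β i
  have hc : Continuous c := continuous_pi fun i =>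
    (continuous_setIntegral_mul_extendZero hD (hφc i)).add continuous_const
  have hU : IsCompact (c '' K) := hK.image hc
  obtain ⟨M₁, hM₁, hgM⟩ := exists_forall_abs_le_of_isCompact hU hg
  obtain ⟨M₂, hM₂, hψM⟩ := exists_forall_abs_le_of_isCompact hDc' hψ
  obtain ⟨δ, hδ, hstable⟩ := exists_pos_forall_abs_sum_mul_sub_le (le_max_of_le_left hM₁)
    (fun j x hx => (hgM j x hx).trans (le_max_left M₁ M₂))
    (fun j x hx => (hψM j x hx).trans (le_max_right M₁ M₂)) (half_pos hε0)
  choose F hF hFg using fun j => hn1 k _ hU (g j) (hg j).continuousOn δ hδ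
  choose κ hκ hκψ using fun j => hn3 d' _ hDc' (ψ j) (hψ j).continuousOn δ hδ
  obtain ⟨N, G, hG, hGF⟩ := exists_neural_operator_features (volume_real_ne_zero hD) D' hφ β hF hκ
  refine ⟨N, G, hG, fun a ha x hx => ?_⟩
  have hfeat : (∫ y in D, fun i => φ i y * extendZero a y) + β = c a := by
    funext i
    rw [Pi.add_apply, eval_integral fun i => integrableOn_mul_extendZero hD (hφc i) a]
  rw [hGF, hfeat]
  calc _ ≤ _ := abs_sub_le _ (∑ j, g j (c a) * ψ j x) _
    _ ≤ ε / 2 + ε / 2 := add_le_add (hnear a ha x hx).le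
      (hstable F κ hFg hκψ (c a) ⟨a, ha, rfl⟩ x hx)
    _ = ε := add_halves ε

end
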